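/- arXiv:2506.15392 — 3 statements merged into one kernel-verified Lean document; each statement's English description precedes it below -/
import Mathlib

section
/- Lemma 5.1, oracle-complexity recurrence. Fix an integer T ≥ 1 and let a : {1,…,T+1} × ℕ → ℕ satisfy: a(t,0) = 0 for all 1 ≤ t ≤ T+1; a(T+1, l) = 0 for all l; and a(t,l) = l + Σ_{l'=1}^{l−1} a(t+1, l') for all 1 ≤ t ≤ T and l ≥ 1. Then for all 1 ≤ t ≤ T and all l ≥ 0: a(t,l) ≤ min( 2^l − 1, l^{T−t+1} ). -/
lemma sum_Icc_two_pow_sub_one (n : ℕ) :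
    n + 1 + ∑ i ∈ Finset.Icc 1 n, (2 ^ i - 1) = 2 ^ (n + 1) - 1 := by
  induction n with
  | zero => simp
  | succ n ih =>
    rw [Finset.sum_Icc_succ_top (by omega)]
    have := Nat.one_le_two_pow (n := n + 1)
    rw [pow_succ 2 (n + 1)]
    omega

lemma add_sum_Icc_pow_le {k : ℕ} (hk : k ≠ 0) (n : ℕ) :
    n + 1 + ∑ i ∈ Finset.Icc 1 n, i ^ k ≤ (n + 1) ^ (k + 1) := by
  have hsum : ∑ i ∈ Finset.Icc 1 n, i ^ k ≤ n * (n + 1) ^ k := by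
    simpa using Finset.sum_le_card_nsmul (Finset.Icc 1 n) (fun i => i ^ k) ((n + 1) ^ k)
      fun i hi => Nat.pow_le_pow_left (by have := (Finset.mem_Icc.mp hi).2; omega) k
  have hle : n + 1 ≤ (n + 1) ^ k := Nat.le_self_pow hk _
  rw [pow_succ]
  linarith

/-- **Lemma 5.1, oracle-complexity recurrence.** If `a(t,0) = 0`, `a(T+1,l) = 0` and
`a(t,l) = l + Σ_{l'=1}^{l-1} a(t+1,l')` for `1 ≤ t ≤ T`, `l ≥ 1`, then
`a(t,l) ≤ min(2^l - 1, l^(T-t+1))` for all `1 ≤ t ≤ T` and `l ≥ 0`. -/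
theorem oracle_complexity_recurrence
    (T : ℕ) (hT : 1 ≤ T) (a : ℕ → ℕ → ℕ)
    (h0 : ∀ t, 1 ≤ t → t ≤ T + 1 → a t 0 = 0)
    (hTop : ∀ l, a (T + 1) l = 0)
    (hrec : ∀ t l, 1 ≤ t → t ≤ T → 1 ≤ l →
      a t l = l + ∑ l' ∈ Finset.Icc 1 (l - 1), a (t + 1) l') :
    ∀ t l, 1 ≤ t → t ≤ T → a t l ≤ min (2 ^ l - 1) (l ^ (T - t + 1)) := by
  have hstep : ∀ t, 1 ≤ t → t ≤ T → ∀ n,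
      a t (n + 1) = n + 1 + ∑ i ∈ Finset.Icc 1 n, a (t + 1) i := fun t h1 h2 n => by
    simpa using hrec t (n + 1) h1 h2 (by omega)
  have hexp : ∀ k t l, 1 ≤ t → t + k = T + 1 → a t l ≤ 2 ^ l - 1 := by
    intro k
    induction k with
    | zero =>
      rintro t l - rfl
      simp [hTop]
    | succ k ih =>
      rintro t (_ | n) h1 h2
      · simp [h0 t h1 (by omega)]
      · rw [hstep t h1 (by omega), ← sum_Icc_two_pow_sub_one]
        gcongr with i
        exact ih (t + 1) i (by omega) (by omega)
  have hpoly : ∀ k t l, 1 ≤ t → t + k = T → a t l ≤ l ^ (k + 1) := by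
    intro k
    induction k with
    | zero =>
      rintro t (_ | n) h1 rfl
      · simp [h0 t h1 (by omega)]
      · have h := hstep t h1 le_rfl n
        simp_all
    | succ k ih =>
      rintro t (_ | n) h1 h2
      · simp [h0 t h1 (by omega)]
      · rw [hstep t h1 (by omega)]
        refine le_trans ?_ (add_sum_Icc_pow_le k.succ_ne_zero n)
        gcongr with i
        exact ih (t + 1) i (by omega) (by omega)
  intro t l h1 h2
  exact le_min (hexp (T + 1 - t) t l h1 (by omega)) (hpoly (T - t) t l h1 (by omega))
end

section
/- Theorem 5.2, total oracle complexity of the online implementation. Fix integers T ≥ 1 and L ≥ 1, and let a : {1,…,T+1} × ℕ → ℕ satisfy a(t,0) = 0 for all t, a(T+1,l) = 0 for all l, and a(t,l) = l + Σ_{l'=1}^{l−1} a(t+1, l') for 1 ≤ t ≤ T and l ≥ 1. Then Σ_{t=1}^{T} a(t, L) ≤ T · min( 2^L − 1, L^T ). -/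
/-- The backward recurrence for the oracle counts, in one-step form. -/
theorem oracleCount_succ {T : ℕ} {a : ℕ → ℕ → ℕ}
    (h0 : ∀ t, 1 ≤ t → t ≤ T + 1 → a t 0 = 0)
    (hrec : ∀ t l, 1 ≤ t → t ≤ T → 1 ≤ l →
      a t l = l + ∑ l' ∈ Finset.Icc 1 (l - 1), a (t + 1) l')
    {t : ℕ} (ht : 1 ≤ t) (htT : t ≤ T) (l : ℕ) :
    a t (l + 1) = a t l + 1 + a (t + 1) l := by
  rcases l with _ | l
  · simp [hrec t 1 ht htT le_rfl, h0 t ht (by omega), h0 (t + 1) (by omega) (by omega)]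
  · rw [hrec t (l + 1 + 1) ht htT (by omega), hrec t (l + 1) ht htT (by omega),
      Nat.add_sub_cancel, Nat.add_sub_cancel, Finset.sum_Icc_succ_top (by omega)]
    omega

theorem pow_succ_add_pow_add_one_le (l k : ℕ) (hk : k ≠ 0) :
    l ^ (k + 1) + 1 + l ^ k ≤ (l + 1) ^ (k + 1) := by
  have h : l ^ k + 1 ≤ (l + 1) ^ k := Nat.pow_lt_pow_left l.lt_succ_self hk
  calc l ^ (k + 1) + 1 + l ^ k ≤ (l ^ k + 1) * (l + 1) := by ring_nf; omega
    _ ≤ (l + 1) ^ k * (l + 1) := Nat.mul_le_mul_right _ h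
    _ = (l + 1) ^ (k + 1) := (pow_succ _ _).symm

/-- With `k` stages left after stage `t`, the oracle count of the `l`-th iterate is at most
`2 ^ l - 1` and at most `l ^ (k + 1)`. -/
theorem oracleCount_le {T : ℕ} {a : ℕ → ℕ → ℕ}
    (h0 : ∀ t, 1 ≤ t → t ≤ T + 1 → a t 0 = 0)
    (hTop : ∀ l, a (T + 1) l = 0)
    (hrec : ∀ t l, 1 ≤ t → t ≤ T → 1 ≤ l →
      a t l = l + ∑ l' ∈ Finset.Icc 1 (l - 1), a (t + 1) l')
    (k : ℕ) {t : ℕ} (ht : 1 ≤ t) (htk : t + k = T) (l : ℕ) :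
    a t l + 1 ≤ 2 ^ l ∧ a t l ≤ l ^ (k + 1) := by
  induction k generalizing t l with
  | zero =>
    obtain rfl : t = T := by omega
    have h : a t l = l := by
      rcases l with _ | l
      · exact h0 t ht (by omega)
      · simp [hrec t (l + 1) ht le_rfl (by omega), hTop]
    rw [h]
    exact ⟨Nat.lt_two_pow_self, by simp⟩
  | succ k ihk =>
    induction l with
    | zero => simp [h0 t ht (by omega)]
    | succ l ihl =>
      have hs := oracleCount_succ h0 hrec ht (by omega) l
      obtain ⟨h₁, h₂⟩ := ihk (t := t + 1) (by omega) (by omega) l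
      refine ⟨?_, ?_⟩
      · rw [pow_succ]
        omega
      · have := pow_succ_add_pow_add_one_le l (k + 1) (by omega)
        omega

/-- **Theorem 5.2, total oracle complexity of the online implementation.** With the
oracle-count recurrence `a(t,0) = 0`, `a(T+1,l) = 0`,
`a(t,l) = l + Σ_{l'=1}^{l-1} a(t+1,l')`, the total number of oracle calls over the `T`
stages satisfies `Σ_{t=1}^T a(t,L) ≤ T·min(2^L - 1, L^T)`. -/
theorem total_oracle_complexity_online
    (T L : ℕ) (hT : 1 ≤ T) (hL : 1 ≤ L) (a : ℕ → ℕ → ℕ)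
    (h0 : ∀ t, 1 ≤ t → t ≤ T + 1 → a t 0 = 0)
    (hTop : ∀ l, a (T + 1) l = 0)
    (hrec : ∀ t l, 1 ≤ t → t ≤ T → 1 ≤ l →
      a t l = l + ∑ l' ∈ Finset.Icc 1 (l - 1), a (t + 1) l') :
    ∑ t ∈ Finset.Icc 1 T, a t L ≤ T * min (2 ^ L - 1) (L ^ T) := by
  have h : ∀ t ∈ Finset.Icc 1 T, a t L ≤ min (2 ^ L - 1) (L ^ T) := by
    intro t ht
    rw [Finset.mem_Icc] at ht
    obtain ⟨h₁, h₂⟩ := oracleCount_le h0 hTop hrec (T - t) ht.1 (by omega) L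
    exact le_min (by omega) (h₂.trans (Nat.pow_le_pow_right hL (by omega)))
  simpa using Finset.sum_le_card_nsmul _ _ _ h
end

section
/- Lemma B.3 (growth of the accelerated parameter sequences). Let L₂ > 0, γ ≥ 0, μ ≥ 0 and θ ∈ [0,1]. Define α₀ = A₀ = 1 and, recursively, let α_{l+1} be the positive real number satisfying (1+γ)L₂ + (1−θ)μ·A_l = (1+γ)L₂·α_{l+1}²/(A_l + α_{l+1}), and A_{l+1} = A_l + α_{l+1}. Then: (i) if μ > 0 and θ < 1, then A_{l+1} ≥ ( 1 + (1/2)·√( (1−θ)μ / ((1+γ)L₂) ) )² · A_l for all l ≥ 0; (ii) if μ = 0 (so that the recursion reads A_l + α_{l+1} = α_{l+1}²), then (l+1)/2 ≤ α_l ≤ l+1 for all l ≥ 0, and consequently (l+1)(l+2)/4 ≤ A_l ≤ (l+1)(l+2)/2 for all l ≥ 0. -/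
/-- One step of the scheme, normalized by `q = s ^ 2`: the weight `a` dominates `(s + s ^ 2 / 2) A`. -/
lemma growth_of_step_eq {s A a : ℝ} (hA : 0 < A) (ha : 0 < a)
    (h : (1 + s ^ 2 * A) * (A + a) = a ^ 2) : (1 + 1 / 2 * s) ^ 2 * A ≤ A + a := by
  have hsq : 0 ≤ s ^ 2 * A := by positivity
  have hlow : s ^ 2 * A ≤ a := by
    refine le_of_mul_le_mul_right ?_ ha
    nlinarith [mul_nonneg hsq hA.le]
  have hkey : s * A ≤ a - s ^ 2 * A / 2 := by
    refine abs_le_of_sq_le_sq' ?_ (by linarith) |>.2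
    nlinarith [sq_nonneg (s ^ 2 * A)]
  nlinarith

/-- The positive solution of `b ^ 2 = a ^ 2 + b` lies in `[a + 1 / 2, a + 1]`. -/
lemma bounds_of_sq_eq_sq_add {a b : ℝ} (ha : 0 < a) (hb : 0 < b) (h : b ^ 2 = a ^ 2 + b) :
    a + 1 / 2 ≤ b ∧ b ≤ a + 1 := by
  have hb1 : 1 < b := by nlinarith [sq_pos_of_pos ha]
  constructor
  · have : a ≤ b - 1 / 2 := abs_le_of_sq_le_sq' (by nlinarith) (by linarith) |>.2
    linarith
  · by_contra! hlt
    nlinarith [mul_pos ha hb]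

/-- **Lemma B.3** (growth of the accelerated parameter sequences). With `α₀ = A₀ = 1`,
`α_{l+1} > 0` solving `(1+γ)L₂ + (1-θ)μA_l = (1+γ)L₂ α_{l+1}²/(A_l + α_{l+1})` and
`A_{l+1} = A_l + α_{l+1}`: (i) if `μ > 0` and `θ < 1` then
`A_{l+1} ≥ (1 + ½√((1-θ)μ/((1+γ)L₂)))² A_l`; (ii) if `μ = 0` then
`(l+1)/2 ≤ α_l ≤ l+1` and `(l+1)(l+2)/4 ≤ A_l ≤ (l+1)(l+2)/2`. -/
theorem accelerated_parameter_growth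
    (L₂ γ μ θ : ℝ) (hL₂ : 0 < L₂) (hγ : 0 ≤ γ) (hμ : 0 ≤ μ)
    (hθ : θ ∈ Set.Icc (0 : ℝ) 1)
    (α A : ℕ → ℝ) (hα0 : α 0 = 1) (hA0 : A 0 = 1)
    (hαpos : ∀ l : ℕ, 0 < α (l + 1))
    (hrec : ∀ l : ℕ, (1 + γ) * L₂ + (1 - θ) * μ * A l
        = (1 + γ) * L₂ * (α (l + 1)) ^ 2 / (A l + α (l + 1)))
    (hA : ∀ l : ℕ, A (l + 1) = A l + α (l + 1)) :
    (0 < μ → θ < 1 →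
      ∀ l : ℕ, (1 + (1 / 2) * Real.sqrt ((1 - θ) * μ / ((1 + γ) * L₂))) ^ 2 * A l
        ≤ A (l + 1)) ∧
    (μ = 0 →
      (∀ l : ℕ, ((l : ℝ) + 1) / 2 ≤ α l ∧ α l ≤ (l : ℝ) + 1) ∧
      (∀ l : ℕ, ((l : ℝ) + 1) * ((l : ℝ) + 2) / 4 ≤ A l ∧
        A l ≤ ((l : ℝ) + 1) * ((l : ℝ) + 2) / 2)) := by
  have hc : 0 < (1 + γ) * L₂ := by positivity
  have hApos : ∀ l, 0 < A l := by
    intro l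
    induction l with
    | zero => simp [hA0]
    | succ k ih => rw [hA]; exact add_pos ih (hαpos k)
  have hq : 0 ≤ (1 - θ) * μ / ((1 + γ) * L₂) :=
    div_nonneg (mul_nonneg (sub_nonneg.2 hθ.2) hμ) hc.le
  have hstep : ∀ l, (1 + (1 - θ) * μ / ((1 + γ) * L₂) * A l) * (A l + α (l + 1))
      = α (l + 1) ^ 2 := by
    intro l
    have hne : A l + α (l + 1) ≠ 0 := (add_pos (hApos l) (hαpos l)).ne'
    have h := hrec l
    rw [eq_div_iff hne] at h
    refine mul_left_cancel₀ hc.ne' ?_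
    have hq' : (1 + γ) * L₂ * ((1 - θ) * μ / ((1 + γ) * L₂)) = (1 - θ) * μ :=
      mul_div_cancel₀ _ hc.ne'
    linear_combination h + A l * (A l + α (l + 1)) * hq'
  refine ⟨fun _ _ l => ?_, fun hμ0 => ?_⟩
  · rw [hA]
    refine growth_of_step_eq (hApos l) (hαpos l) ?_
    rw [Real.sq_sqrt hq, hstep]
  · have hsq : ∀ l, α l ^ 2 = A l := by
      intro l
      cases l with
      | zero => simp [hα0, hA0]
      | succ k => rw [← hstep, hA, hμ0]; ring
    have hαpos' : ∀ l, 0 < α l := by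
      intro l
      cases l with
      | zero => simp [hα0]
      | succ k => exact hαpos k
    have hα : ∀ l : ℕ, ((l : ℝ) + 1) / 2 ≤ α l ∧ α l ≤ (l : ℝ) + 1 := by
      intro l
      induction l with
      | zero => norm_num [hα0]
      | succ k ih =>
        have h := bounds_of_sq_eq_sq_add (hαpos' k) (hαpos k) (by rw [hsq, hsq, hA])
        push_cast
        constructor <;> linarith [h.1, h.2, ih.1, ih.2]
    refine ⟨hα, fun l => ?_⟩
    induction l with
    | zero => norm_num [hA0]
    | succ k ih =>
      have h := hα (k + 1)
      rw [hA]
      push_cast at h ⊢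
      constructor <;> linarith [h.1, h.2, ih.1, ih.2]
end
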